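/- arXiv:1301.3998 — 4 statements merged into one kernel-verified Lean document; each statement's English description precedes it below -/
import Mathlib

section
/- The Picard group of the ring Z[T]/(T³ + 1) is trivial. -/
open Polynomial TensorProduct

/-- The ring `ℤ[T]/(T³ + 1)`. -/
abbrev RingT3add1 : Type := ℤ[X] ⧸ Ideal.span {(X : ℤ[X]) ^ 3 + 1}

namespace Module.Invertible

variable {R : Type*} [CommRing R] {M : Type*} [AddCommGroup M] [Module R M] [Module.Invertible R M]

theorem exists_span_singleton_sup_smul_top (I : Ideal R) [Subsingleton (CommRing.Pic (R ⧸ I))] :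
    ∃ m : M, Submodule.span R {m} ⊔ I • (⊤ : Submodule R M) = ⊤ := by
  obtain ⟨e⟩ := free_iff_linearEquiv.mp
    (inferInstance : Module.Free (R ⧸ I) ((R ⧸ I) ⊗[R] M))
  let e' : (R ⧸ I) ≃ₗ[R] M ⧸ I • (⊤ : Submodule R M) :=
    (e.restrictScalars R).symm ≪≫ₗ TensorProduct.quotTensorEquivQuotSMul M I
  obtain ⟨m, hm⟩ := Submodule.Quotient.mk_surjective _ (e' 1)
  refine ⟨m, eq_top_iff.mpr fun x _ ↦ ?_⟩
  obtain ⟨r, hr⟩ := Ideal.Quotient.mk_surjective (e'.symm (Submodule.Quotient.mk x))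
  have hx : Submodule.Quotient.mk x = r • e' 1 := by
    rw [← map_smul, Algebra.smul_def, mul_one, Ideal.Quotient.algebraMap_eq, hr,
      LinearEquiv.apply_symm_apply]
  rw [← hm, ← Submodule.Quotient.mk_smul, Submodule.Quotient.eq] at hx
  have := Submodule.add_mem_sup (Submodule.smul_mem _ r (Submodule.mem_span_singleton_self m)) hx
  rwa [add_sub_cancel] at this

theorem mem_of_forall_smul_mem_smul_top {I : Ideal R} {r : R}
    (h : ∀ x : M, r • x ∈ I • (⊤ : Submodule R M)) : r ∈ I := by
  rw [← Ideal.Quotient.eq_zero_iff_mem]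
  refine FaithfulSMul.eq_of_smul_eq_smul (α := (R ⧸ I) ⊗[R] M) fun t ↦ ?_
  apply (TensorProduct.quotTensorEquivQuotSMul M I).injective
  obtain ⟨x, hx⟩ := Submodule.Quotient.mk_surjective _ (TensorProduct.quotTensorEquivQuotSMul M I t)
  have : (Ideal.Quotient.mk I r) • t = r • t := by
    rw [← Ideal.Quotient.algebraMap_eq, algebraMap_smul]
  rw [this, zero_smul, map_zero, map_smul, ← hx, ← Submodule.Quotient.mk_smul,
    Submodule.Quotient.mk_eq_zero]
  exact h x

end Module.Invertible

namespace CommRing.Pic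

/-- A consequence of the units-Picard Mayer-Vietoris sequence: if `I * J = ⊥`, the Picard groups of
`R ⧸ I` and `R ⧸ J` are trivial and units lift along `R → R ⧸ (I ⊔ J)`, then the Picard group of
`R` is trivial. -/
theorem subsingleton_of_mul_eq_bot {R : Type*} [CommRing R] (I J : Ideal R) (hIJ : I * J = ⊥)
    [Subsingleton (CommRing.Pic (R ⧸ I))] [Subsingleton (CommRing.Pic (R ⧸ J))]
    (hu : Function.Surjective (Units.map (Ideal.Quotient.mk (I ⊔ J)).toMonoidHom)) :
    Subsingleton (CommRing.Pic R) := by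
  refine subsingleton_iff.mpr fun M _ _ _ ↦ ?_
  obtain ⟨m, hm⟩ := Module.Invertible.exists_span_singleton_sup_smul_top (M := M) I
  obtain ⟨n, hn⟩ := Module.Invertible.exists_span_singleton_sup_smul_top (M := M) J
  have mem_m (x : M) : ∃ r : R, ∃ y ∈ I • (⊤ : Submodule R M), r • m + y = x := by
    have : x ∈ Submodule.span R {m} ⊔ I • (⊤ : Submodule R M) := hm.ge Submodule.mem_top
    obtain ⟨_, hr, y, hy, rfl⟩ := Submodule.mem_sup.mp this
    obtain ⟨r, rfl⟩ := Submodule.mem_span_singleton.mp hr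
    exact ⟨r, y, hy, rfl⟩
  obtain ⟨r, y, hy, hry⟩ := mem_m n
  have : m ∈ Submodule.span R {n} ⊔ J • (⊤ : Submodule R M) := hn.ge Submodule.mem_top
  obtain ⟨_, hs, z, hz, hsz⟩ := Submodule.mem_sup.mp this
  obtain ⟨s, rfl⟩ := Submodule.mem_span_singleton.mp hs
  have hI : I • (⊤ : Submodule R M) ≤ (I ⊔ J) • ⊤ := Submodule.smul_mono_left le_sup_left
  have hJ : J • (⊤ : Submodule R M) ≤ (I ⊔ J) • ⊤ := Submodule.smul_mono_left le_sup_right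
  have hsr : 1 - s * r ∈ I ⊔ J := by
    refine Module.Invertible.mem_of_forall_smul_mem_smul_top (M := M) fun x ↦ ?_
    obtain ⟨t, w, hw, rfl⟩ := mem_m x
    have : (1 - s * r) • m = s • y + z := by
      linear_combination (norm := module) -hsz - s • hry
    rw [smul_add, smul_comm, this]
    exact add_mem (Submodule.smul_mem _ _ (add_mem (Submodule.smul_mem _ _ (hI hy)) (hJ hz)))
      (Submodule.smul_mem _ _ (hI hw))
  have hrs : Ideal.Quotient.mk (I ⊔ J) r * Ideal.Quotient.mk (I ⊔ J) s = 1 := by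
    rw [← map_mul, ← map_one (Ideal.Quotient.mk _), eq_comm, Ideal.Quotient.eq, mul_comm]
    exact hsr
  obtain ⟨u, hur⟩ := hu ⟨_, _, hrs, by rw [mul_comm, hrs]⟩
  replace hur : Ideal.Quotient.mk (I ⊔ J) r = Ideal.Quotient.mk (I ⊔ J) u :=
    congr_arg Units.val hur.symm
  obtain ⟨a, ha, b, hb, hab⟩ := Submodule.mem_sup.mp (Ideal.Quotient.eq.mp hur)
  -- `p` agrees with `u • m` modulo `I` and with `n` modulo `J`
  let p : M := n - b • m
  have hpm : Submodule.span R {p} ⊔ I • (⊤ : Submodule R M) = ⊤ := by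
    refine eq_top_iff.mpr (hm.ge.trans (sup_le ?_ le_sup_right))
    rw [Submodule.span_singleton_le_iff_mem]
    have h : m = (↑u⁻¹ : R) • p + (↑u⁻¹ : R) • (-(a • m) - y) := by
      have : p + (-(a • m) - y) = (u : R) • m := by
        linear_combination (norm := module) -hry - congr($hab • m)
      rw [← smul_add, this, smul_smul, Units.inv_mul, one_smul]
    rw [h]
    exact Submodule.add_mem_sup (Submodule.smul_mem _ _ (Submodule.mem_span_singleton_self p))
      (Submodule.smul_mem _ _ (sub_mem
        (neg_mem (Submodule.smul_mem_smul ha Submodule.mem_top)) hy))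
  have hpn : Submodule.span R {p} ⊔ J • (⊤ : Submodule R M) = ⊤ := by
    refine eq_top_iff.mpr (hn.ge.trans (sup_le ?_ le_sup_right))
    rw [Submodule.span_singleton_le_iff_mem, show n = p + b • m by simp [p]]
    exact Submodule.add_mem_sup (Submodule.mem_span_singleton_self p)
      (Submodule.smul_mem_smul hb Submodule.mem_top)
  have hp : Submodule.span R {p} = ⊤ := by
    refine eq_top_iff.mpr (hpm.ge.trans (sup_le le_rfl ?_))
    nth_rw 1 [← hpn]
    rw [Submodule.smul_sup, ← Submodule.mul_smul, hIJ, Submodule.bot_smul, sup_bot_eq]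
    exact Submodule.smul_le_right
  exact .of_equiv <| .ofBijective (LinearMap.toSpanSingleton R M p) <|
    Module.Invertible.bijective_of_surjective <| LinearMap.range_eq_top.mp <| by
      rw [LinearMap.range_toSpanSingleton, hp]

theorem subsingleton_quotient_ker {R : Type*} {A : Type*} [CommRing R] [CommRing A]
    [Subsingleton (CommRing.Pic A)] {f : R →+* A} (hf : Function.Surjective f) :
    Subsingleton (CommRing.Pic (R ⧸ RingHom.ker f)) := by
  let e := RingHom.quotientKerEquivOfSurjective hf
  refine Function.Injective.subsingleton (f := mapRingHom e.toRingHom) <|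
    Function.LeftInverse.injective (g := mapRingHom e.symm.toRingHom) fun P ↦ ?_
  rw [mapRingHom_mapRingHom]
  have : e.symm.toRingHom.comp e.toRingHom = RingHom.id _ := by ext; simp
  rw [this, mapRingHom_id_apply]

end CommRing.Pic

theorem Int.cast_eq_cast_emod_of_natCast_eq_zero {S : Type*} [Ring S] {k : ℕ} (hk : (k : S) = 0)
    (n : ℤ) : (n : S) = ((n % k : ℤ) : S) := by
  nth_rw 1 [← Int.emod_add_mul_ediv n k]
  simp [hk]

namespace RingT3add1

/-- The ring homomorphism out of `ℤ[T]/(T³ + 1)` sending `T` to a given root of `T³ + 1`. -/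
noncomputable def lift {A : Type*} [CommRing A] (x : A) (hx : x ^ 3 + 1 = 0) : RingT3add1 →+* A :=
  Ideal.Quotient.lift _ (aeval x : ℤ[X] →ₐ[ℤ] A).toRingHom fun p hp ↦ by
    obtain ⟨q, rfl⟩ := Ideal.mem_span_singleton.mp hp
    simp [hx]

@[simp]
theorem lift_mk {A : Type*} [CommRing A] (x : A) (hx : x ^ 3 + 1 = 0) (p : ℤ[X]) :
    lift x hx (Ideal.Quotient.mk _ p) = aeval x p :=
  rfl

theorem lift_surjective {A : Type*} [CommRing A] {x : A} (hx : x ^ 3 + 1 = 0)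
    (h : Algebra.adjoin ℤ {x} = ⊤) : Function.Surjective (lift x hx) := fun y ↦ by
  have hy : y ∈ Algebra.adjoin ℤ {x} := h ▸ Algebra.mem_top
  rw [Algebra.adjoin_singleton_eq_range_aeval] at hy
  obtain ⟨p, rfl⟩ := hy
  exact ⟨Ideal.Quotient.mk _ p, rfl⟩

theorem ker_lift_mul_ker_lift {A L : Type*} [CommRing A] [Field L] [CharZero L] {φ : A →+* L}
    (hφ : Function.Injective φ) {x : A} (hx : x ^ 3 + 1 = 0) (hx6 : IsPrimitiveRoot x 6) :
    RingHom.ker (lift (-1 : ℤ) (by norm_num)) * RingHom.ker (lift x hx) = ⊥ := by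
  rw [eq_bot_iff, Ideal.mul_le]
  intro r hr s hs
  obtain ⟨p, rfl⟩ := Ideal.Quotient.mk_surjective r
  obtain ⟨q, rfl⟩ := Ideal.Quotient.mk_surjective s
  rw [RingHom.mem_ker, lift_mk] at hr hs
  have hp : X - C (-1) ∣ p := dvd_iff_isRoot.mpr (by simpa [aeval_def] using hr)
  have hq : X ^ 2 - X + 1 ∣ q := by
    have hy := hx6.map_of_injective hφ
    rw [← cyclotomic_six, cyclotomic_eq_minpoly hy (by norm_num)]
    refine minpoly.isIntegrallyClosed_dvd (hy.isIntegral (by norm_num)) ?_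
    simpa [hs] using aeval_algHom_apply φ.toIntAlgHom x q
  rw [← map_mul, Ideal.mem_bot, Ideal.Quotient.eq_zero_iff_mem, Ideal.mem_span_singleton]
  convert mul_dvd_mul hp hq using 1
  simp only [map_neg, map_one]
  ring

theorem units_map_surjective (K : Ideal RingT3add1)
    (h₁ : Ideal.Quotient.mk _ (X + 1) ∈ K) (h₂ : Ideal.Quotient.mk _ (X ^ 2 - X + 1) ∈ K) :
    Function.Surjective (Units.map (Ideal.Quotient.mk K).toMonoidHom) := by
  let π : ℤ[X] →+* RingT3add1 ⧸ K := (Ideal.Quotient.mk K).comp (Ideal.Quotient.mk _)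
  have hX : π X = -1 := eq_neg_of_add_eq_zero_left <| by
    simpa [π] using Ideal.Quotient.eq_zero_iff_mem.mpr h₁
  have h3 : (3 : RingT3add1 ⧸ K) = 0 := by
    have : π (X ^ 2 - X + 1) = 0 := Ideal.Quotient.eq_zero_iff_mem.mpr h₂
    rw [map_add, map_sub, map_pow, hX, map_one] at this
    linear_combination this
  have hπ : π = (Int.castRingHom (RingT3add1 ⧸ K)).comp (evalRingHom (-1)) :=
    Polynomial.ringHom_ext (by simp) (by simp [hX])
  intro u
  obtain ⟨r, hr⟩ := Ideal.Quotient.mk_surjective (u : RingT3add1 ⧸ K)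
  obtain ⟨p, rfl⟩ := Ideal.Quotient.mk_surjective r
  have hu : (u : RingT3add1 ⧸ K) = ((p.eval (-1) : ℤ) : RingT3add1 ⧸ K) := by
    rw [← hr]
    exact congr($hπ p)
  have hmod : (u : RingT3add1 ⧸ K) = ((p.eval (-1) % 3 : ℤ) : RingT3add1 ⧸ K) := by
    rw [hu]
    exact Int.cast_eq_cast_emod_of_natCast_eq_zero (by exact_mod_cast h3) _
  have : p.eval (-1) % 3 = 0 ∨ p.eval (-1) % 3 = 1 ∨ p.eval (-1) % 3 = 2 := by omega
  obtain h | h | h := this <;> rw [h] at hmod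
  · have : Subsingleton (RingT3add1 ⧸ K) :=
      subsingleton_of_zero_eq_one <| isUnit_zero_iff.mp <| by
        simpa only [hmod, Int.cast_zero] using u.isUnit
    exact ⟨1, Subsingleton.elim _ _⟩
  · exact ⟨1, Units.ext (by simp [hmod])⟩
  · refine ⟨-1, Units.ext ?_⟩
    simp only [Int.cast_ofNat] at hmod
    simp [hmod]
    linear_combination -h3

instance : Subsingleton (CommRing.Pic RingT3add1) := by
  let K := CyclotomicField 3 ℚ
  have : IsCyclotomicExtension {3} ℚ K := CyclotomicField.isCyclotomicExtension 3 ℚ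
  have hζ := IsCyclotomicExtension.zeta_spec 3 ℚ K
  have : IsPrincipalIdealRing (NumberField.RingOfIntegers K) :=
    IsCyclotomicExtension.Rat.three_pid K
  let ζ := hζ.toInteger
  have hζ3 : IsPrimitiveRoot ζ 3 := hζ.toInteger_isPrimitiveRoot
  have hx : (-ζ) ^ 3 + 1 = 0 := by linear_combination -hζ3.pow_eq_one
  have hx6 : IsPrimitiveRoot (-ζ) 6 := by
    convert! IsPrimitiveRoot.orderOf (-ζ)
    rw [neg_eq_neg_one_mul, (Commute.all _ _).orderOf_mul_eq_mul_orderOf_of_coprime] <;>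
      simp [← hζ3.eq_orderOf, Nat.odd_iff]
  have hadj : Algebra.adjoin ℤ {-ζ} = ⊤ := by
    rw [← IsCyclotomicExtension.Rat.adjoin_singleton_eq_top hζ]
    refine le_antisymm (Algebra.adjoin_singleton_le ?_) (Algebra.adjoin_singleton_le ?_)
    · exact neg_mem (Algebra.self_mem_adjoin_singleton ℤ ζ)
    · simpa using neg_mem (Algebra.self_mem_adjoin_singleton ℤ (-ζ))
  have h₁ : Function.Surjective (lift (-1 : ℤ) (by norm_num)) :=
    fun n ↦ ⟨n, by simp⟩
  have := CommRing.Pic.subsingleton_quotient_ker h₁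
  have := CommRing.Pic.subsingleton_quotient_ker (lift_surjective hx hadj)
  refine CommRing.Pic.subsingleton_of_mul_eq_bot _ _ (ker_lift_mul_ker_lift
    (φ := algebraMap _ K) NumberField.RingOfIntegers.coe_injective hx hx6)
    (units_map_surjective _ (Ideal.mem_sup_left ?_) (Ideal.mem_sup_right ?_))
  · simp [RingHom.mem_ker]
  · have := hx6.isRoot_cyclotomic (by norm_num)
    simpa [RingHom.mem_ker, cyclotomic_six] using this

end RingT3add1

/-- The Picard group of `ℤ[T]/(T³ + 1)` is trivial, i.e. every rank-one
projective (= invertible) module over `ℤ[T]/(T³ + 1)` is free. -/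
theorem stmt4 (M : Type) [AddCommGroup M] [Module RingT3add1 M]
    [Module.Projective RingT3add1 M]
    (hinv : ∃ (N : Type) (_ : AddCommGroup N) (_ : Module RingT3add1 N),
      Nonempty ((M ⊗[RingT3add1] N) ≃ₗ[RingT3add1] RingT3add1)) :
    Module.Free RingT3add1 M := by
  obtain ⟨N, _, _, ⟨e⟩⟩ := hinv
  have : Module.Invertible RingT3add1 M := .left e
  infer_instance
end

section
/- Let L be a field and G a group acting on the rational function field L(x) by automorphisms such that every σ ∈ G maps L into L and σ(x) = a_σ x + b_σ with a_σ, b_σ ∈ L, a_σ ≠ 0. Then the fixed field L(x)^G is a rational (purely transcendental of transcendence degree ≤ 1) extension of L^G; in fact L(x)^G = L^G or L(x)^G = L^G(z) for some z. -/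
open Polynomial

/-- A field automorphism preserving `L` and acting affinely on `x` acts on the polynomials in `x`
over `L` without changing degrees. -/
theorem exists_aeval_eq_smul {F : Type*} [Field F] {L : Subfield F} {x : F}
    {G : Type*} [Group G] [MulSemiringAction G F]
    (hL : ∀ σ : G, ∀ c ∈ L, σ • c ∈ L)
    (haff : ∀ σ : G, ∃ a ∈ L, ∃ b ∈ L, a ≠ 0 ∧ σ • x = a * x + b) (σ : G) (p : L[X]) :
    ∃ p' : L[X], aeval x p' = σ • aeval x p ∧ p'.degree = p.degree := by
  obtain ⟨a, ha, b, hb, ha0, hσ⟩ := haff σ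
  let φ : L →+* L := ((MulSemiringAction.toRingHom G F σ).comp L.subtype).codRestrict L
    fun c => hL σ c c.2
  have ha0' : (⟨a, ha⟩ : L) ≠ 0 := fun h => ha0 (congrArg Subtype.val h)
  refine ⟨(p.map φ).comp (C ⟨a, ha⟩ * X + C ⟨b, hb⟩), ?_, ?_⟩
  · rw [aeval_comp]
    have hlin : aeval x (C (⟨a, ha⟩ : L) * X + C ⟨b, hb⟩) = σ • x := by
      simp only [map_add, map_mul, aeval_C, aeval_X, hσ]
      rfl
    rw [hlin]
    induction p using Polynomial.induction_on' with
    | add p q hp hq => simp [hp, hq]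
    | monomial n c =>
      simp only [map_monomial, aeval_monomial, smul_mul', smul_pow']
      rfl
  · rcases eq_or_ne p 0 with rfl | hp
    · simp
    have hn : (C (⟨a, ha⟩ : L) * X + C (⟨b, hb⟩ : L)).natDegree = 1 := natDegree_linear ha0'
    have hp' : p.map φ ≠ 0 := (Polynomial.map_ne_zero_iff φ.injective).2 hp
    have hc : (p.map φ).comp (C ⟨a, ha⟩ * X + C ⟨b, hb⟩) ≠ 0 := by
      intro h
      rcases comp_eq_zero_iff.1 h with h | h
      · exact hp' h
      · rw [h.2, natDegree_C] at hn
        exact zero_ne_one hn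
    rw [degree_eq_natDegree hc, degree_eq_natDegree hp, natDegree_comp, hn, mul_one, natDegree_map]

/-- The polynomial part of an invariant fraction is invariant. -/
theorem aeval_div_mem_fixedPoints {F : Type*} [Field F] {L : Subfield F} {x : F}
    (hx : Transcendental L x) {G : Type*} [Group G] [MulSemiringAction G F]
    (hL : ∀ σ : G, ∀ c ∈ L, σ • c ∈ L)
    (haff : ∀ σ : G, ∃ a ∈ L, ∃ b ∈ L, a ≠ 0 ∧ σ • x = a * x + b) {f g : L[X]} (hg : g ≠ 0)
    (h : aeval x f / aeval x g ∈ FixedPoints.subfield G F) :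
    aeval x (f / g) ∈ FixedPoints.subfield G F := by
  intro σ
  have hinj : Function.Injective (aeval x : L[X] →ₐ[L] F) :=
    transcendental_iff_injective.1 hx
  obtain ⟨q', hq', -⟩ := exists_aeval_eq_smul hL haff σ (f / g)
  obtain ⟨r', hr', hrd⟩ := exists_aeval_eq_smul hL haff σ (f % g)
  obtain ⟨g', hg', hgd⟩ := exists_aeval_eq_smul hL haff σ g
  have hg0' : g' ≠ 0 := by
    rw [← degree_ne_bot, hgd]
    exact degree_ne_bot.2 hg
  have hgx : aeval x g ≠ 0 := fun h0 => hg (hinj (by simpa using h0))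
  have hgx' : aeval x g' ≠ 0 := fun h0 => hg0' (hinj (by simpa using h0))
  have hf : aeval x f = aeval x g * aeval x (f / g) + aeval x (f % g) := by
    rw [← map_mul, ← map_add, EuclideanDomain.div_add_mod]
  have hfix : σ • (aeval x f / aeval x g) = aeval x f / aeval x g := h σ
  rw [smul_div₀', ← hg', div_eq_div_iff hgx' hgx, hf, smul_add, smul_mul', ← hg', ← hq',
    ← hr'] at hfix
  have hpoly : (q' - f / g) * (g * g') = f % g * g' - r' * g := by
    apply hinj
    simp only [map_mul, map_sub]
    linear_combination hfix
  have hrg : (f % g).degree < g.degree := EuclideanDomain.mod_lt f hg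
  have hlt : ((q' - f / g) * (g * g')).degree < (g * g').degree := by
    rw [hpoly]
    refine (degree_sub_le _ _).trans_lt (max_lt ?_ ?_)
    · rw [degree_mul, degree_mul]
      exact WithBot.add_lt_add_right (degree_ne_bot.2 hg0') hrg
    · rw [degree_mul, degree_mul, add_comm, hgd, hrd]
      exact WithBot.add_lt_add_left (degree_ne_bot.2 hg) hrg
  have hq : q' - f / g = 0 := by
    by_contra hne
    rw [mul_comm] at hlt
    exact (degree_le_mul_left (g * g') hne).not_gt hlt
  rw [← hq', sub_eq_zero.1 hq]

/-- An invariant fraction lies in every subfield containing all invariant polynomials, by the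
Euclidean algorithm. -/
theorem div_mem_of_forall_aeval_mem {F : Type*} [Field F] {L : Subfield F} {x : F}
    (hx : Transcendental L x) {G : Type*} [Group G] [MulSemiringAction G F]
    (hL : ∀ σ : G, ∀ c ∈ L, σ • c ∈ L)
    (haff : ∀ σ : G, ∃ a ∈ L, ∃ b ∈ L, a ≠ 0 ∧ σ • x = a * x + b) {K : Subfield F}
    (hK : ∀ p : L[X], aeval x p ∈ FixedPoints.subfield G F → aeval x p ∈ K) (f g : L[X])
    (h : aeval x f / aeval x g ∈ FixedPoints.subfield G F) : aeval x f / aeval x g ∈ K := by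
  induction g using (EuclideanDomain.r_wellFounded (R := L[X])).induction generalizing f with
  | _ g ih =>
  rcases eq_or_ne g 0 with rfl | hg
  · simp
  have hgx : aeval x g ≠ 0 := fun h0 =>
    hg (transcendental_iff_injective.1 hx (by simpa using h0))
  have hq := aeval_div_mem_fixedPoints hx hL haff hg h
  have hf : aeval x f / aeval x g = aeval x (f / g) + aeval x (f % g) / aeval x g := by
    rw [eq_comm, ← mul_div_cancel_left₀ (aeval x (f / g)) hgx, ← add_div, ← map_mul, ← map_add,
      EuclideanDomain.div_add_mod]
  have hr : aeval x (f % g) / aeval x g ∈ FixedPoints.subfield G F := by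
    rw [← sub_eq_iff_eq_add'.2 hf]
    exact sub_mem h hq
  rw [hf]
  refine add_mem (hK _ hq) ?_
  rw [← inv_div]
  exact inv_mem (ih _ (EuclideanDomain.mod_lt f hg) g (by rw [← inv_div]; exact inv_mem hr))

/-- Let `L` be a field and `G` a group acting on the rational function field
`L(x)` by automorphisms such that every `σ ∈ G` maps `L` into `L` and
`σ(x) = a_σ x + b_σ` with `a_σ, b_σ ∈ L`, `a_σ ≠ 0`. Then the fixed field `L(x)^G` is a
rational (purely transcendental of transcendence degree ≤ 1) extension of `L^G`:
`L(x)^G = L^G` or `L(x)^G = L^G(z)` for some `z` transcendental over `L^G`. -/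
theorem stmt11 (F : Type*) [Field F] (L : Subfield F) (x : F)
    (hx : Transcendental L x)
    (hgen : Subfield.closure ((L : Set F) ∪ {x}) = ⊤)
    (G : Type*) [Group G] [MulSemiringAction G F]
    (hL : ∀ σ : G, ∀ c ∈ L, σ • c ∈ L)
    (haff : ∀ σ : G, ∃ a ∈ L, ∃ b ∈ L, a ≠ 0 ∧ σ • x = a * x + b) :
    FixedPoints.subfield G F = (FixedPoints.subfield G F ⊓ L) ∨
      ∃ z : F, Transcendental (↥(FixedPoints.subfield G F ⊓ L)) z ∧
        FixedPoints.subfield G F =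
          Subfield.closure (((FixedPoints.subfield G F ⊓ L) : Set F) ∪ {z}) := by
  classical
  have key : ∀ K : Subfield F, K ≤ FixedPoints.subfield G F →
      (∀ p : L[X], aeval x p ∈ FixedPoints.subfield G F → aeval x p ∈ K) →
      FixedPoints.subfield G F = K := by
    refine fun K hKle hK => le_antisymm (fun y hy => ?_) hKle
    have hle : Subring.closure ((L : Set F) ∪ {x}) ≤ (aeval x : L[X] →ₐ[L] F).toRingHom.range := by
      rw [Subring.closure_le]
      rintro c (hc | rfl)
      · exact ⟨C ⟨c, hc⟩, aeval_C x _⟩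
      · exact ⟨X, by simp⟩
    have hy' : y ∈ Subfield.closure ((L : Set F) ∪ {x}) := hgen ▸ Subfield.mem_top y
    obtain ⟨u, hu, v, hv, rfl⟩ := Subfield.mem_closure_iff.1 hy'
    obtain ⟨f, rfl⟩ := hle hu
    obtain ⟨g, rfl⟩ := hle hv
    exact div_mem_of_forall_aeval_mem hx hL haff hK f g hy
  have hconst : ∀ p : L[X], p.natDegree = 0 → aeval x p ∈ FixedPoints.subfield G F →
      aeval x p ∈ FixedPoints.subfield G F ⊓ L := by
    refine fun p hp h => ⟨h, ?_⟩
    rw [eq_C_of_natDegree_eq_zero hp, aeval_C]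
    exact (p.coeff 0).2
  by_cases hex : ∃ n, ∃ p : L[X], aeval x p ∈ FixedPoints.subfield G F ∧
      p.natDegree ≠ 0 ∧ p.natDegree = n
  · right
    obtain ⟨p, hp, hp0, hpn⟩ := Nat.find_spec hex
    have hmin : ∀ q : L[X], aeval x q ∈ FixedPoints.subfield G F →
        q.natDegree < p.natDegree → q.natDegree = 0 := by
      intro q hq hlt
      by_contra h0
      exact Nat.find_min hex (hpn ▸ hlt) ⟨q, hq, h0, rfl⟩
    have hpz : p ≠ 0 := by
      rintro rfl
      exact hp0 natDegree_zero
    refine ⟨aeval x p, ?_, key _ ?_ fun f hf => ?_⟩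
    · have hpL : Transcendental L (aeval x p) :=
        hx.aeval p hp0 (mem_nonZeroDivisors_of_ne_zero (leadingCoeff_ne_zero.2 hpz))
      let : Algebra ↥(FixedPoints.subfield G F ⊓ L) L :=
        (Subfield.inclusion inf_le_right).toAlgebra
      have : IsScalarTower ↥(FixedPoints.subfield G F ⊓ L) L F :=
        IsScalarTower.of_algebraMap_eq fun _ => rfl
      exact hpL.restrictScalars (FaithfulSMul.algebraMap_injective _ _)
    · rw [Subfield.closure_le]
      rintro c (hc | rfl)
      · exact hc.1
      · exact hp
    · have hpK := Subfield.subset_closure (s := ((FixedPoints.subfield G F ⊓ L : Subfield F) :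
        Set F) ∪ {aeval x p}) (Or.inr rfl)
      induction hn : f.natDegree using Nat.strong_induction_on generalizing f with
      | _ n ih =>
      by_cases hlt : f.natDegree < p.natDegree
      · exact Subfield.subset_closure (Or.inl (hconst f (hmin f hf hlt) hf))
      have hq := aeval_div_mem_fixedPoints hx hL haff hpz (div_mem hf hp)
      have hsplit : aeval x f = aeval x p * aeval x (f / p) + aeval x (f % p) := by
        rw [← map_mul, ← map_add, EuclideanDomain.div_add_mod]
      have hr : aeval x (f % p) ∈ FixedPoints.subfield G F := by
        rw [← sub_eq_iff_eq_add'.2 hsplit]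
        exact sub_mem hf (mul_mem hp hq)
      have hqd : (f / p).natDegree < n := by
        rcases eq_or_ne (f / p) 0 with h0 | h0
        · rw [h0, natDegree_zero]
          omega
        rw [← hn]
        refine natDegree_lt_natDegree h0 (degree_div_lt ?_
          (natDegree_pos_iff_degree_pos.1 (by omega)))
        rintro rfl
        exact h0 EuclideanDomain.zero_div
      rw [hsplit]
      exact add_mem (mul_mem hpK (ih _ hqd _ hq rfl))
        (Subfield.subset_closure (Or.inl
          (hconst _ (hmin _ hr (natDegree_mod_lt f hp0)) hr)))
  · left
    refine key _ inf_le_left fun p hp => hconst p ?_ hp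
    by_contra h0
    exact hex ⟨_, p, hp, h0, rfl⟩
end

section
/- Let K be a field of characteristic 0 and ρ the K-automorphism of K(w₁, w₂) defined by ρ(w₁) = w₂, ρ(w₂) = -w₁ - w₂ + 1. Then the fixed field K(w₁, w₂)^⟨ρ⟩ is a rational function field in two variables over K. -/
open scoped IntermediateField.algebraAdjoinAdjoin in
/-- If the field `F` has transcendence degree at least two over `K` and is algebraic over
`K(s, t)`, then `s` and `t` are algebraically independent. -/
theorem algebraicIndependent_pair_of_isAlgebraic_adjoin {K F : Type*} [Field K] [Field F]
    [Algebra K F] {x y s t : F} (hind : AlgebraicIndependent K ![x, y])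
    (halg : Algebra.IsAlgebraic (IntermediateField.adjoin K {s, t}) F) :
    AlgebraicIndependent K ![s, t] := by
  have hrange : Set.range ![s, t] = {s, t} := by
    simp [Matrix.range_cons, Set.pair_comm]
  have : Algebra.IsAlgebraic (Algebra.adjoin K (Set.range ![s, t])) F := by
    rw [hrange]
    exact (IsFractionRing.comap_isAlgebraic_iff (A := Algebra.adjoin K {s, t})
      (K := IntermediateField.adjoin K {s, t}) (C := F)).mpr halg
  exact (Algebra.IsAlgebraic.isTranscendenceBasis_of_lift_le_trdeg_of_finite K ![s, t]
    hind.lift_cardinalMk_le_trdeg).1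

/-- A polynomial that does not vanish at some rational point does not vanish at an
algebraically independent pair. -/
theorem AlgebraicIndependent.aeval_pair_ne_zero {K F : Type*} [Field K] [Field F] [Algebra K F]
    {x y : F} (hind : AlgebraicIndependent K ![x, y]) (p : MvPolynomial (Fin 2) K) (a b : K)
    (hp : MvPolynomial.eval ![a, b] p ≠ 0) : MvPolynomial.aeval ![x, y] p ≠ 0 := by
  intro h
  have : p = 0 := hind.eq_zero_of_aeval_eq_zero p h
  simp [this] at hp

/-- Power sums of the roots of a monic cubic over `L` lie in `L`. -/
theorem pow_add_pow_add_pow_mem {F : Type*} [Field F] (L : Subfield F) {a b c : F}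
    (h₁ : a + b + c ∈ L) (h₂ : a * b + b * c + c * a ∈ L) (h₃ : a * b * c ∈ L) (n : ℕ) :
    a ^ n + b ^ n + c ^ n ∈ L := by
  induction n using Nat.strong_induction_on with
  | _ n ih =>
    match n with
    | 0 => simpa using L.add_mem (L.add_mem L.one_mem L.one_mem) L.one_mem
    | 1 => simpa using h₁
    | 2 =>
      have : a ^ 2 + b ^ 2 + c ^ 2 = (a + b + c) * (a + b + c) -
          ((a * b + b * c + c * a) + (a * b + b * c + c * a)) := by ring
      rw [this]
      exact L.sub_mem (L.mul_mem h₁ h₁) (L.add_mem h₂ h₂)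
    | n + 3 =>
      have : a ^ (n + 3) + b ^ (n + 3) + c ^ (n + 3) =
          (a + b + c) * (a ^ (n + 2) + b ^ (n + 2) + c ^ (n + 2)) -
          (a * b + b * c + c * a) * (a ^ (n + 1) + b ^ (n + 1) + c ^ (n + 1)) +
          a * b * c * (a ^ n + b ^ n + c ^ n) := by ring
      rw [this]
      exact L.add_mem (L.sub_mem (L.mul_mem h₁ (ih _ (by omega))) (L.mul_mem h₂ (ih _ (by omega))))
        (L.mul_mem h₃ (ih _ (by omega)))

/-- Sums of polynomial values over the roots of a monic cubic over `L` lie in `L`. -/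
theorem aeval_add_aeval_add_aeval_mem {K F : Type*} [Field K] [Field F] [Algebra K F]
    (L : IntermediateField K F) {a b c : F} (h₁ : a + b + c ∈ L)
    (h₂ : a * b + b * c + c * a ∈ L) (h₃ : a * b * c ∈ L) (q : Polynomial L) :
    Polynomial.aeval a q + Polynomial.aeval b q + Polynomial.aeval c q ∈ L := by
  induction q using Polynomial.induction_on' with
  | add p q hp hq =>
    convert L.add_mem hp hq using 1
    simp only [map_add]
    ring
  | monomial n r =>
    simp only [Polynomial.aeval_monomial, ← mul_add]
    exact L.mul_mem r.2 (pow_add_pow_add_pow_mem L.toSubfield h₁ h₂ h₃ n)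

/-- Suppose `u` generates `F` over `L`, the automorphism `ρ` fixes `L` pointwise, and `u`, `ρ u`,
`ρ (ρ u)` have their elementary symmetric functions in `L`. Then `F` is algebraic over `L`, and
every element fixed by `ρ` lies in `L`. -/
theorem isAlgebraic_and_mem_of_cyclic_cubic {K F : Type*} [Field K] [CharZero K] [Field F]
    [Algebra K F] (ρ : F ≃ₐ[K] F) (L : IntermediateField K F) (hL : ∀ v ∈ L, ρ v = v) {u : F}
    (h₁ : u + ρ u + ρ (ρ u) ∈ L) (h₂ : u * ρ u + ρ u * ρ (ρ u) + ρ (ρ u) * u ∈ L)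
    (h₃ : u * ρ u * ρ (ρ u) ∈ L) (hu : IntermediateField.adjoin L {u} = ⊤) :
    Algebra.IsAlgebraic L F ∧ ∀ v, ρ v = v → v ∈ L := by
  have hint : IsIntegral L u := by
    refine ⟨Polynomial.X ^ 3 - Polynomial.C ⟨_, h₁⟩ * Polynomial.X ^ 2 +
      Polynomial.C ⟨_, h₂⟩ * Polynomial.X - Polynomial.C ⟨_, h₃⟩, by monicity!, ?_⟩
    simp only [Polynomial.eval₂_sub, Polynomial.eval₂_add, Polynomial.eval₂_mul,
      Polynomial.eval₂_pow, Polynomial.eval₂_X, Polynomial.eval₂_C,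
      IntermediateField.algebraMap_apply]
    ring
  refine ⟨?_, fun v hv ↦ ?_⟩
  · have := IntermediateField.isAlgebraic_adjoin_simple hint
    rw [hu] at this
    exact IntermediateField.topEquiv.isAlgebraic
  · have hmem : v ∈ (IntermediateField.adjoin L {u}).toSubalgebra := by simp [hu]
    rw [IntermediateField.adjoin_simple_toSubalgebra_of_isAlgebraic hint.isAlgebraic,
      Algebra.adjoin_singleton_eq_range_aeval] at hmem
    obtain ⟨q, rfl⟩ := hmem
    have hmap (w : F) : ρ (Polynomial.aeval w q) = Polynomial.aeval (ρ w) q := by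
      clear hv
      induction q using Polynomial.induction_on' with
      | add p q hp hq => simp [hp, hq]
      | monomial n r => simp [Polynomial.aeval_monomial, hL]
    have hsum := aeval_add_aeval_add_aeval_mem L h₁ h₂ h₃ q
    rw [← hmap (ρ u), ← hmap u] at hsum
    change ρ (Polynomial.aeval u q) = Polynomial.aeval u q at hv
    rw [hv, hv] at hsum
    have : CharZero F := charZero_of_injective_algebraMap (algebraMap K F).injective
    have h3 : (3 : F)⁻¹ ∈ L := L.inv_mem (ofNat_mem L 3)
    convert L.mul_mem h3 hsum using 1
    change Polynomial.aeval u q = _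
    ring

/-- Let `K` be a field of characteristic 0 and `ρ` the `K`-automorphism of
`K(w₁,w₂)` with `ρ(w₁) = w₂`, `ρ(w₂) = -w₁ - w₂ + 1`. Then the fixed field
`K(w₁,w₂)^⟨ρ⟩` is a rational function field in two variables over `K`. -/
theorem stmt13 (K F : Type*) [Field K] [CharZero K] [Field F] [Algebra K F]
    (w₁ w₂ : F) (hind : AlgebraicIndependent K ![w₁, w₂])
    (hgen : IntermediateField.adjoin K {w₁, w₂} = ⊤)
    (ρ : F ≃ₐ[K] F) (h1 : ρ w₁ = w₂) (h2 : ρ w₂ = -w₁ - w₂ + 1) :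
    ∃ s t : F, AlgebraicIndependent K ![s, t] ∧
      IntermediateField.fixedField (Subgroup.zpowers ρ) = IntermediateField.adjoin K {s, t} := by
  have : CharZero F := charZero_of_injective_algebraMap (algebraMap K F).injective
  obtain ⟨x, hx⟩ : ∃ x, x = w₁ - 1 / 3 := ⟨_, rfl⟩
  obtain ⟨y, hy⟩ : ∃ y, y = w₂ - 1 / 3 := ⟨_, rfl⟩
  have hρx : ρ x = y := by simp [hx, hy, h1, map_ofNat ρ 3]
  have hρy : ρ y = -(x + y) := by
    simp only [hx, hy, map_sub, map_div₀, map_one, map_ofNat, h2]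
    ring
  have hne : x * y * (x + y) * (x ^ 2 + x * y + y ^ 2) ≠ 0 := by
    let X : MvPolynomial (Fin 2) K := .X 0 - .C (1 / 3)
    let Y : MvPolynomial (Fin 2) K := .X 1 - .C (1 / 3)
    have := hind.aeval_pair_ne_zero (X * Y * (X + Y) * (X ^ 2 + X * Y + Y ^ 2)) (4 / 3) (4 / 3)
      (by simp [X, Y]; norm_num)
    simpa [X, Y, hx, hy, map_ofNat (algebraMap K F) 3] using this
  obtain ⟨⟨⟨hx0, hy0⟩, hxy⟩, hq⟩ : ((x ≠ 0 ∧ y ≠ 0) ∧ x + y ≠ 0) ∧ x ^ 2 + x * y + y ^ 2 ≠ 0 := by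
    simpa [not_or] using hne
  obtain ⟨u, hu⟩ : ∃ u, u = y / x := ⟨_, rfl⟩
  have hρu : ρ u = -(x + y) / y := by rw [hu, map_div₀, hρy, hρx]
  have hρρu : ρ (ρ u) = -(x / (x + y)) := by
    rw [hρu, map_div₀, map_neg, map_add, hρx, hρy, neg_add, ← sub_eq_add_neg]
    field_simp
    ring
  obtain ⟨s, hs⟩ : ∃ s, s = x * y * (x + y) / (x ^ 2 + x * y + y ^ 2) := ⟨_, rfl⟩
  obtain ⟨t, ht⟩ : ∃ t, t = u + ρ u + ρ (ρ u) := ⟨_, rfl⟩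
  have hρs : ρ s = s := by
    have hq' : y ^ 2 + y * -(x + y) + (-(x + y)) ^ 2 = x ^ 2 + x * y + y ^ 2 := by ring
    simp only [hs, map_div₀, map_mul, map_add, map_pow, hρx, hρy, hq']
    ring
  have hρt : ρ t = t := by
    have : ρ (ρ (ρ u)) = u := by
      have h : y + -(x + y) = -x := by ring
      rw [hρρu, map_neg, map_div₀, map_add, hρx, hρy, h, hu, div_neg, neg_neg]
    rw [ht, map_add, map_add, this]
    ring
  obtain ⟨L, hLdef⟩ : ∃ L, L = IntermediateField.adjoin K {s, t} := ⟨_, rfl⟩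
  have hsL : s ∈ L := hLdef ▸ IntermediateField.subset_adjoin K _ (by simp)
  have htL : t ∈ L := hLdef ▸ IntermediateField.subset_adjoin K _ (by simp)
  have hLfix : L ≤ IntermediateField.fixedField (Subgroup.zpowers ρ) := by
    rw [hLdef, IntermediateField.adjoin_le_iff]
    have key (v : F) (hv : ρ v = v) : v ∈ IntermediateField.fixedField (Subgroup.zpowers ρ) := by
      rw [IntermediateField.mem_fixedField_iff]
      intro f hf
      have : Subgroup.zpowers ρ ≤ MulAction.stabilizer (F ≃ₐ[K] F) v := by
        rw [Subgroup.zpowers_le]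
        exact hv
      exact this hf
    rintro v (rfl | rfl)
    exacts [key _ hρs, key _ hρt]
  have hL (v : F) (hv : v ∈ L) : ρ v = v :=
    (IntermediateField.mem_fixedField_iff _ _).mp (hLfix hv) ρ (Subgroup.mem_zpowers ρ)
  have htop : IntermediateField.adjoin L {u} = ⊤ := by
    have huM : u ∈ IntermediateField.adjoin L {u} := IntermediateField.mem_adjoin_simple_self L u
    have hsM : s ∈ IntermediateField.adjoin L {u} :=
      (IntermediateField.adjoin L {u}).algebraMap_mem ⟨s, hsL⟩
    have h3M : (1 / 3 : F) ∈ IntermediateField.adjoin L {u} :=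
      div_mem (one_mem _) (ofNat_mem _ 3)
    have hxM : x ∈ IntermediateField.adjoin L {u} := by
      have : x = s * (1 + u + u ^ 2) / (u * (1 + u)) := by
        have h1u : 1 + u = (x + y) / x := by
          rw [hu, add_div, div_self hx0]
        have hqu : 1 + u + u ^ 2 = (x ^ 2 + x * y + y ^ 2) / x ^ 2 := by
          rw [hu]
          field_simp
        rw [hqu, h1u, hs, hu]
        generalize x ^ 2 + x * y + y ^ 2 = Q at hq
        field_simp
      rw [this]
      exact div_mem (mul_mem hsM (add_mem (add_mem (one_mem _) huM) (pow_mem huM 2)))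
        (mul_mem huM (add_mem (one_mem _) huM))
    have hyM : y ∈ IntermediateField.adjoin L {u} := by
      have : y = u * x := by rw [hu, div_mul_cancel₀ _ hx0]
      exact this ▸ mul_mem huM hxM
    have hle : IntermediateField.adjoin K {w₁, w₂} ≤
        (IntermediateField.adjoin L {u}).restrictScalars K := by
      rw [IntermediateField.adjoin_le_iff]
      rintro v (rfl | rfl)
      · simpa [hx] using add_mem hxM h3M
      · simpa [hy] using add_mem hyM h3M
    rw [hgen] at hle
    exact top_unique fun v _ ↦ hle (IntermediateField.mem_top (x := v))
  have he₂ : u * ρ u + ρ u * ρ (ρ u) + ρ (ρ u) * u = -3 - t := by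
    rw [ht, hρρu, hρu, hu]
    field_simp
    ring
  have he₃ : u * ρ u * ρ (ρ u) = 1 := by
    rw [hρρu, hρu, hu]
    field_simp
  obtain ⟨halg, hfix⟩ := isAlgebraic_and_mem_of_cyclic_cubic ρ L hL (ht ▸ htL)
    (he₂ ▸ sub_mem (neg_mem (ofNat_mem L 3)) htL) (he₃ ▸ one_mem L) htop
  refine ⟨s, t, algebraicIndependent_pair_of_isAlgebraic_adjoin hind (hLdef ▸ halg), ?_⟩
  rw [← hLdef]
  refine le_antisymm (fun v hv ↦ hfix v ?_) hLfix
  exact (IntermediateField.mem_fixedField_iff _ _).mp hv ρ (Subgroup.mem_zpowers ρ)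
end

section
/- Let σ, τ be Q-automorphisms of the rational function field Q(z₁, z₂) defined by σ(z₁) = z₂, σ(z₂) = -1/(z₁z₂), τ(z₁) = -z₁z₂, τ(z₂) = 1/z₂. Then σ³ = τ² = 1, τστ⁻¹ = σ⁻¹ (so ⟨σ,τ⟩ ≅ S₃), and the fixed field Q(z₁, z₂)^⟨σ,τ⟩ is rational (purely transcendental) over Q. -/
open IntermediateField Polynomial

theorem IntermediateField.algEquiv_eqOn_adjoin {k F : Type*} [Field k] [Field F] [Algebra k F]
    {S : Set F} {f g : F ≃ₐ[k] F} (h : Set.EqOn f g S) : Set.EqOn f g (adjoin k S) := by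
  intro x hx
  induction hx using adjoin_induction with
  | mem x hx => exact h hx
  | algebraMap x => simp
  | add x y _ _ hx hy => simp [hx, hy]
  | inv x _ hx => simp [hx]
  | mul x y _ _ hx hy => simp [hx, hy]

theorem IntermediateField.algEquiv_ext_of_adjoin_eq_top {k F : Type*} [Field k] [Field F]
    [Algebra k F] {S : Set F} (hS : adjoin k S = ⊤) {f g : F ≃ₐ[k] F} (h : Set.EqOn f g S) :
    f = g :=
  AlgEquiv.ext fun _ => algEquiv_eqOn_adjoin h (hS ▸ mem_top)

theorem IntermediateField.isSplittingField_cubic {k F : Type*} [Field k] [Field F] [Algebra k F]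
    (K : IntermediateField k F) {a b c : F} {e₁ e₂ e₃ : K} (h₁ : (e₁ : F) = a + b + c)
    (h₂ : (e₂ : F) = a * b + b * c + c * a) (h₃ : (e₃ : F) = a * b * c)
    (hgen : adjoin k {a, b} = ⊤) :
    (X ^ 3 - C e₁ * X ^ 2 + C e₂ * X - C e₃ : K[X]).IsSplittingField K F := by
  set p : K[X] := X ^ 3 - C e₁ * X ^ 2 + C e₂ * X - C e₃ with hp
  have hmap : p.map (algebraMap K F) = (X - C a) * (X - C b) * (X - C c) := by
    simp only [hp, Polynomial.map_sub, Polynomial.map_add, Polynomial.map_mul, Polynomial.map_pow,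
      map_X, map_C, IntermediateField.algebraMap_apply, h₁, h₂, h₃, C_add, C_mul]
    ring
  have hmap0 : p.map (algebraMap K F) ≠ 0 := by
    rw [hmap]
    exact mul_ne_zero (mul_ne_zero (X_sub_C_ne_zero a) (X_sub_C_ne_zero b)) (X_sub_C_ne_zero c)
  have hroot {x : F} (hx : (x - a) * (x - b) * (x - c) = 0) : x ∈ p.rootSet F := by
    rw [mem_rootSet', aeval_def, ← eval_map, hmap]
    exact ⟨hmap ▸ hmap0, by simpa using hx⟩
  rw [isSplittingField_iff_intermediateField]
  refine ⟨?_, ?_⟩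
  · rw [hmap]
    exact ((Splits.X_sub_C a).mul (Splits.X_sub_C b)).mul (Splits.X_sub_C c)
  · have hle : adjoin k {a, b} ≤ (adjoin K (p.rootSet F)).restrictScalars k := by
      rw [adjoin_le_iff]
      rintro x (rfl | rfl) <;> exact subset_adjoin K _ (hroot (by ring))
    rw [hgen] at hle
    exact eq_top_iff.2 fun x _ => hle mem_top

theorem IntermediateField.fixedField_closure_eq_adjoin {k F : Type*} [Field k] [CharZero k]
    [Field F] [Algebra k F] {a b c : F} (hsum : a + b + c = 1) (hab : a ≠ b)
    (hgen : adjoin k {a, b} = ⊤) {σ τ : F ≃ₐ[k] F} (hσa : σ a = b) (hσb : σ b = c)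
    (hτa : τ a = a) (hτb : τ b = c) :
    FiniteDimensional (adjoin k {a * b + b * c + c * a, a * b * c}) F ∧
      fixedField (Subgroup.closure {σ, τ}) =
        adjoin k {a * b + b * c + c * a, a * b * c} := by
  have hc : 1 - a - b = c := by rw [← hsum]; ring
  have hσc : σ c = a := by rw [← hc]; simp only [map_sub, map_one, hσa, hσb, ← hc]; ring
  have hτc : τ c = b := by rw [← hc]; simp only [map_sub, map_one, hτa, hτb, ← hc]; ring
  set s := a * b + b * c + c * a with hs
  set t := a * b * c with ht
  set K := adjoin k {s, t}
  let s' : K := ⟨s, subset_adjoin k _ (by simp)⟩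
  let t' : K := ⟨t, subset_adjoin k _ (by simp)⟩
  have hsplit := K.isSplittingField_cubic (e₁ := 1) (e₂ := s') (e₃ := t')
    (by simp [hsum]) hs ht hgen
  have hfin : FiniteDimensional K F := IsSplittingField.finiteDimensional F
    (X ^ 3 - C 1 * X ^ 2 + C s' * X - C t' : K[X])
  have hnormal : Normal K F := Normal.of_isSplittingField
    (X ^ 3 - C 1 * X ^ 2 + C s' * X - C t' : K[X])
  have : CharZero K := charZero_of_injective_algebraMap (algebraMap k K).injective
  have : IsGalois K F := ⟨⟩
  refine ⟨hfin, le_antisymm (fun x hx => ?_) ?_⟩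
  · suffices h : x ∈ (⊥ : IntermediateField K F) by
      obtain ⟨y, rfl⟩ := mem_bot.1 h
      exact y.2
    rw [IsGalois.mem_bot_iff_fixed]
    intro f
    have hfs : f s = s := f.commutes s'
    have hft : f t = t := f.commutes t'
    have hroot (x : F) (hx : (x - a) * (x - b) * (x - c) = 0) : f x = a ∨ f x = b ∨ f x = c := by
      have h : f x ^ 3 - f x ^ 2 + s * f x - t = 0 := by
        nth_rw 1 [← hfs, ← hft]
        rw [← map_pow, ← map_pow, ← map_mul, ← map_sub, ← map_add, ← map_sub,
          map_eq_zero_iff f f.injective, ← hx]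
        linear_combination x ^ 2 * hsum
      have h' : (f x - a) * ((f x - b) * (f x - c)) = 0 := by
        rw [← h]
        linear_combination (-f x ^ 2) * hsum
      simpa [sub_eq_zero] using h'
    suffices h : ∃ g ∈ Subgroup.closure {σ, τ}, f a = g a ∧ f b = g b by
      obtain ⟨g, hg, ha, hb⟩ := h
      have hfg : f.restrictScalars k = g := by
        refine algEquiv_ext_of_adjoin_eq_top hgen ?_
        rintro y (rfl | rfl) <;> assumption
      rw [mem_fixedField_iff] at hx
      exact (DFunLike.congr_fun hfg x).trans (hx g hg)
    have hσ : σ ∈ Subgroup.closure {σ, τ} := Subgroup.subset_closure (by simp)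
    have hτ : τ ∈ Subgroup.closure {σ, τ} := Subgroup.subset_closure (by simp)
    have hne : f a ≠ f b := f.injective.ne hab
    rcases hroot a (by ring) with ha | ha | ha <;> rcases hroot b (by ring) with hb | hb | hb <;>
      rw [ha, hb] at hne ⊢
    · exact absurd rfl hne
    · exact ⟨1, one_mem _, by simp⟩
    · exact ⟨τ, hτ, by simp [*]⟩
    · exact ⟨σ * τ, mul_mem hσ hτ, by simp [*]⟩
    · exact absurd rfl hne
    · exact ⟨σ, hσ, by simp [*]⟩
    · exact ⟨σ * σ, mul_mem hσ hσ, by simp [*]⟩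
    · exact ⟨τ * σ, mul_mem hτ hσ, by simp [*]⟩
    · exact absurd rfl hne
  · rw [le_iff_le, Subgroup.closure_le]
    have hfix (g : F ≃ₐ[k] F) (hgs : g s = s) (hgt : g t = t) : g ∈ K.fixingSubgroup := by
      rw [mem_fixingSubgroup_iff]
      exact fun x hx => algEquiv_eqOn_adjoin (f := g) (g := 1)
        (by rintro y (rfl | rfl) <;> assumption) hx
    rintro g (rfl | rfl)
    · exact hfix _ (by simp only [hs, map_add, map_mul, hσa, hσb, hσc]; ring)
        (by simp only [ht, map_mul, hσa, hσb, hσc]; ring)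
    · exact hfix _ (by simp only [hs, map_add, map_mul, hτa, hτb, hτc]; ring)
        (by simp only [ht, map_mul, hτa, hτb, hτc]; ring)

theorem AlgebraicIndependent.of_finiteDimensional_adjoin {k F ι : Type*} [Field k] [Field F]
    [Algebra k F] [Finite ι] {x y : ι → F} (hx : AlgebraicIndependent k x)
    [FiniteDimensional (adjoin k (Set.range y)) F] : AlgebraicIndependent k y := by
  open scoped algebraAdjoinAdjoin in
  have : Algebra.IsAlgebraic (Algebra.adjoin k (Set.range y)) F :=
    (IsFractionRing.comap_isAlgebraic_iff (K := adjoin k (Set.range y))).2 inferInstance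
  exact (Algebra.IsAlgebraic.isTranscendenceBasis_of_lift_le_trdeg_of_finite k y
    hx.lift_cardinalMk_le_trdeg).1

theorem AlgebraicIndependent.aeval_ne_zero_of_constantCoeff_ne_zero {R A ι : Type*} [CommRing R]
    [CommRing A] [Algebra R A] {x : ι → A} (hx : AlgebraicIndependent R x) {p : MvPolynomial ι R}
    (hp : MvPolynomial.constantCoeff p ≠ 0) : MvPolynomial.aeval x p ≠ 0 := by
  intro h
  rw [hx.eq_zero_of_aeval_eq_zero p h] at hp
  simp at hp


/-- Let `σ, τ` be the `ℚ`-automorphisms of `ℚ(z₁,z₂)` with `σ(z₁) = z₂`,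
`σ(z₂) = -1/(z₁z₂)`, `τ(z₁) = -z₁z₂`, `τ(z₂) = 1/z₂`. Then `σ³ = τ² = 1`,
`τστ⁻¹ = σ⁻¹` (so `⟨σ,τ⟩ ≅ S₃`), and the fixed field `ℚ(z₁,z₂)^⟨σ,τ⟩` is rational
(purely transcendental) over `ℚ`. -/
theorem stmt14 (F : Type*) [Field F] [Algebra ℚ F]
    (z₁ z₂ : F) (hind : AlgebraicIndependent ℚ ![z₁, z₂])
    (hgen : IntermediateField.adjoin ℚ {z₁, z₂} = ⊤)
    (σ τ : F ≃ₐ[ℚ] F)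
    (hσ1 : σ z₁ = z₂) (hσ2 : σ z₂ = -1 / (z₁ * z₂))
    (hτ1 : τ z₁ = -(z₁ * z₂)) (hτ2 : τ z₂ = 1 / z₂) :
    σ ^ 3 = 1 ∧ τ ^ 2 = 1 ∧ τ * σ * τ⁻¹ = σ⁻¹ ∧
      ∃ s t : F, AlgebraicIndependent ℚ ![s, t] ∧
        IntermediateField.fixedField (Subgroup.closure {σ, τ}) =
          IntermediateField.adjoin ℚ {s, t} := by
  have h₁ : z₁ ≠ 0 := hind.ne_zero 0
  have h₂ : z₂ ≠ 0 := hind.ne_zero 1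
  have hz₁ : z₁ + 1 ≠ 0 := by
    simpa using hind.aeval_ne_zero_of_constantCoeff_ne_zero (p := .X 0 + 1) (by simp)
  have he : 1 - z₂ + z₁ * z₂ ≠ 0 := by
    simpa using hind.aeval_ne_zero_of_constantCoeff_ne_zero
      (p := 1 - .X 1 + .X 0 * .X 1) (by simp)
  have hext {f g : F ≃ₐ[ℚ] F} (hf₁ : f z₁ = g z₁) (hf₂ : f z₂ = g z₂) : f = g :=
    algEquiv_ext_of_adjoin_eq_top hgen (by rintro x (rfl | rfl) <;> assumption)
  have hσ3 : σ ^ 3 = 1 := by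
    refine hext ?_ ?_ <;> simp [pow_succ, hσ1, hσ2] <;> field_simp
  have hτ_sq : τ ^ 2 = 1 := by
    refine hext ?_ ?_ <;> simp [pow_succ, hτ1, hτ2, h₂]
  refine ⟨hσ3, hτ_sq, ?_, ?_⟩
  · rw [mul_inv_eq_iff_eq_mul, eq_inv_mul_iff_mul_eq]
    refine hext ?_ ?_ <;> simp [hσ1, hσ2, hτ1, hτ2] <;> field_simp
  set e := 1 - z₂ + z₁ * z₂ with he_def
  have hσe : σ e = e / (z₁ * z₂) := by
    simp only [he_def, map_add, map_sub, map_mul, map_one, hσ1, hσ2]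
    field_simp
    ring
  have hτe : τ e = -e / z₂ := by
    simp only [he_def, map_add, map_sub, map_mul, map_one, hτ1, hτ2]
    field_simp
    ring
  obtain ⟨a, ha⟩ : ∃ a, a = z₁ * z₂ / e := ⟨_, rfl⟩
  obtain ⟨b, hb⟩ : ∃ b, b = -z₂ / e := ⟨_, rfl⟩
  obtain ⟨c, hc⟩ : ∃ c, c = 1 / e := ⟨_, rfl⟩
  have hsum : a + b + c = 1 := by
    rw [ha, hb, hc]
    field_simp
    rw [he_def]
    ring
  have hgen' : adjoin ℚ {a, b} = ⊤ := by
    have haK : a ∈ adjoin ℚ {a, b} := subset_adjoin ℚ _ (by simp)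
    have hbK : b ∈ adjoin ℚ {a, b} := subset_adjoin ℚ _ (by simp)
    rw [eq_top_iff, ← hgen, adjoin_le_iff]
    rintro x (rfl | rfl)
    · have : x = -(a / b) := by rw [ha, hb]; field_simp
      exact this ▸ neg_mem (div_mem haK hbK)
    · have : x = -(b / (1 - a - b)) := by
        rw [show 1 - a - b = c by rw [← hsum]; ring, hb, hc]; field_simp
      exact this ▸ neg_mem (div_mem hbK (sub_mem (sub_mem (one_mem _) haK) hbK))
  obtain ⟨hfin, hfixed⟩ := fixedField_closure_eq_adjoin hsum
    (fun h => hz₁ (by rw [ha, hb] at h; field_simp at h; linear_combination h))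
    hgen' (σ := σ) (τ := τ)
    (by simp only [ha, hb, map_div₀, map_mul, hσe, hσ1, hσ2]; field_simp)
    (by simp only [hb, hc, map_div₀, map_neg, hσe, hσ2]; field_simp)
    (by simp only [ha, map_div₀, map_mul, hτe, hτ1, hτ2]; field_simp)
    (by simp only [hb, hc, map_div₀, map_neg, hτe, hτ2]; field_simp)
  refine ⟨_, _, ?_, hfixed⟩
  rw [← Matrix.range_cons_cons_empty _ _ ![]] at hfin
  exact hind.of_finiteDimensional_adjoin
end
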